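/- arXiv:1712.04584 — 6 statements merged into one kernel-verified Lean document; each statement's English description precedes it below -/
import Mathlib

section
/- Let u, v, s, t be real numbers with u - t·v ≠ 0, 1 - s·u ≠ 0 and 1 - s·v ≠ 0, and let g ≥ 1 be a natural number. Then ((1 - s·t^g·u)·(1 - s²·t^(g-1))·v) / ((1 - s·u)·(1 - s·v)) = ((1 - s·t^g·v)·(1 - s²·t^(g-1))·u) / ((1 - s·v)·(1 - s·u)) · ((1 - t)·v / (u - t·v)) + ((1 - s²·t^(g-1))·v·(1 - s·t^(g-1)·u)) / ((1 - s·v)·(1 - s·u)) · (t·(u - v) / (u - t·v)). -/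
/-- Yang-Baxter identity (YB1.3). -/
theorem YB1_3 (u v s t : ℝ) (g : ℕ) (hg : 1 ≤ g)
    (h1 : u - t * v ≠ 0) (h2 : 1 - s * u ≠ 0) (h3 : 1 - s * v ≠ 0) :
    ((1 - s * t ^ g * u) * (1 - s ^ 2 * t ^ (g - 1)) * v) /
        ((1 - s * u) * (1 - s * v)) =
      ((1 - s * t ^ g * v) * (1 - s ^ 2 * t ^ (g - 1)) * u) /
          ((1 - s * v) * (1 - s * u)) * ((1 - t) * v / (u - t * v)) +
        ((1 - s ^ 2 * t ^ (g - 1)) * v * (1 - s * t ^ (g - 1) * u)) /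
          ((1 - s * v) * (1 - s * u)) * (t * (u - v) / (u - t * v)) := by
  obtain ⟨k, rfl⟩ := Nat.exists_eq_add_of_le' hg
  rw [Nat.add_sub_cancel, pow_succ]
  generalize t ^ k = T
  rw [mul_comm (1 - s * v) (1 - s * u), div_mul_div_comm, div_mul_div_comm, ← add_div,
    div_eq_div_iff (mul_ne_zero h2 h3) (mul_ne_zero (mul_ne_zero h2 h3) h1)]
  ring
end

section
/- Let u, v, s, t be real numbers with u - t·v ≠ 0, 1 - s·u ≠ 0 and 1 - s·v ≠ 0, and let g ≥ 1 be a natural number. Then ((1 - t)·u / (u - t·v)) · ((u - s·t^g)·(1 - s·t^g·v)) / ((1 - s·u)·(1 - s·v)) + (t·(u - v) / (u - t·v)) · ((1 - s²·t^(g-1))·u·(1 - t^g)) / ((1 - s·u)·(1 - s·v)) = ((v - s·t^g)·(1 - s·t^g·u)) / ((1 - s·v)·(1 - s·u)) · ((1 - t)·u / (u - t·v)) + ((1 - t^(g+1))·(1 - s²·t^g)·u) / ((1 - s·v)·(1 - s·u)) · ((u - v) / (u - t·v)). -/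
/-- Yang-Baxter identity (YB2.2). -/
theorem YB2_2 (u v s t : ℝ) (g : ℕ) (hg : 1 ≤ g)
    (h1 : u - t * v ≠ 0) (h2 : 1 - s * u ≠ 0) (h3 : 1 - s * v ≠ 0) :
    ((1 - t) * u / (u - t * v)) *
        ((u - s * t ^ g) * (1 - s * t ^ g * v)) / ((1 - s * u) * (1 - s * v)) +
      (t * (u - v) / (u - t * v)) *
        ((1 - s ^ 2 * t ^ (g - 1)) * u * (1 - t ^ g)) / ((1 - s * u) * (1 - s * v)) =
    ((v - s * t ^ g) * (1 - s * t ^ g * u)) / ((1 - s * v) * (1 - s * u)) *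
        ((1 - t) * u / (u - t * v)) +
      ((1 - t ^ (g + 1)) * (1 - s ^ 2 * t ^ g) * u) / ((1 - s * v) * (1 - s * u)) *
        ((u - v) / (u - t * v)) := by
  obtain ⟨n, rfl⟩ := Nat.exists_eq_add_of_le' hg
  rw [Nat.add_sub_cancel]
  field_simp
  ring
end

section
/- Let u, v, s, t be real numbers with u - t·v ≠ 0, 1 - s·u ≠ 0 and 1 - s·v ≠ 0, and let g ≥ 1 be a natural number. Then ((1 - t)·u / (u - t·v)) · ((u - s·t^g)·(1 - s²·t^(g-1))·v) / ((1 - s·u)·(1 - s·v)) + (t·(u - v) / (u - t·v)) · ((1 - s²·t^(g-1))·u·(v - s·t^(g-1))) / ((1 - s·u)·(1 - s·v)) = ((v - s·t^g)·(1 - s²·t^(g-1))·u) / ((1 - s·v)·(1 - s·u)). -/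
/-- Yang-Baxter identity (YB2.4). -/
theorem YB2_4 (u v s t : ℝ) (g : ℕ) (hg : 1 ≤ g)
    (h1 : u - t * v ≠ 0) (h2 : 1 - s * u ≠ 0) (h3 : 1 - s * v ≠ 0) :
    ((1 - t) * u / (u - t * v)) *
        ((u - s * t ^ g) * (1 - s ^ 2 * t ^ (g - 1)) * v) / ((1 - s * u) * (1 - s * v)) +
      (t * (u - v) / (u - t * v)) *
        ((1 - s ^ 2 * t ^ (g - 1)) * u * (v - s * t ^ (g - 1))) / ((1 - s * u) * (1 - s * v)) =
    ((v - s * t ^ g) * (1 - s ^ 2 * t ^ (g - 1)) * u) / ((1 - s * v) * (1 - s * u)) := by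
  obtain ⟨n, rfl⟩ := Nat.exists_eq_add_of_le' hg
  rw [Nat.add_sub_cancel, pow_succ, mul_comm (1 - s * v) (1 - s * u), ← add_div]
  congr 1
  field_simp
  ring
end

section
/- Let u, v, s, t be real numbers with u - t·v ≠ 0, 1 - s·u ≠ 0 and 1 - s·v ≠ 0, and let g ≥ 1 be a natural number. Then ((1 - t)·v / (u - t·v)) · ((1 - s·t^g·u)·(v - s·t^g)) / ((1 - s·u)·(1 - s·v)) + ((u - v) / (u - t·v)) · ((1 - t^(g+1))·(1 - s²·t^g)·v) / ((1 - s·u)·(1 - s·v)) = ((1 - s·t^g·v)·(u - s·t^g)) / ((1 - s·v)·(1 - s·u)) · ((1 - t)·v / (u - t·v)) + ((1 - s²·t^(g-1))·v·(1 - t^g)) / ((1 - s·v)·(1 - s·u)) · (t·(u - v) / (u - t·v)). -/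
/-- Yang-Baxter identity (YB3.3). -/
theorem YB3_3 (u v s t : ℝ) (g : ℕ) (hg : 1 ≤ g)
    (h1 : u - t * v ≠ 0) (h2 : 1 - s * u ≠ 0) (h3 : 1 - s * v ≠ 0) :
    ((1 - t) * v / (u - t * v)) *
        ((1 - s * t ^ g * u) * (v - s * t ^ g)) / ((1 - s * u) * (1 - s * v)) +
      ((u - v) / (u - t * v)) *
        ((1 - t ^ (g + 1)) * (1 - s ^ 2 * t ^ g) * v) / ((1 - s * u) * (1 - s * v)) =
    ((1 - s * t ^ g * v) * (u - s * t ^ g)) / ((1 - s * v) * (1 - s * u)) *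
        ((1 - t) * v / (u - t * v)) +
      ((1 - s ^ 2 * t ^ (g - 1)) * v * (1 - t ^ g)) / ((1 - s * v) * (1 - s * u)) *
        (t * (u - v) / (u - t * v)) := by
  obtain ⟨k, rfl⟩ := Nat.exists_eq_add_of_le' hg
  rw [Nat.add_sub_cancel, mul_comm (1 - s * v) (1 - s * u)]
  simp only [div_eq_mul_inv]
  ring
end

section
/- Let t, s, u, v be real numbers satisfying 0 ≤ t < 1, -1 < s ≤ 0, and 0 < v ≤ u. Then for every natural number g, each of the following seven quantities lies in the closed interval [0,1]: (u - v)/(u - t·v); ((1 - s·t^g·u)·(v - s·t^g)) / ((1 - s·t^g·v)·(u - s·t^g)); ((1 - t)·(1 - s²·t^(2g))) / ((1 - t^(g+1))·(1 - s²·t^g)); (1 - s·t^(g+1)·v)/(1 - s·t^g·v); (t - s·t^(g+1)·u)/(1 - s·t^(g+1)·u); (t·v - s·t^(g+1))/(v - s·t^(g+1)); (u - s·t^(g+1))/(u - s·t^g). Moreover, all denominators appearing above are strictly positive. -/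
/-- Nonnegativity of the quantities controlling the forward and backward
Yang-Baxter transition weights: under `0 ≤ t < 1`, `-1 < s ≤ 0`, `0 < v ≤ u`,
the seven quantities lie in `[0,1]` and all denominators are strictly
positive. -/
theorem transition_weights_quantities_in_unit_interval
    (t s u v : ℝ)
    (ht0 : 0 ≤ t) (ht1 : t < 1) (hs0 : -1 < s) (hs1 : s ≤ 0)
    (hv : 0 < v) (huv : v ≤ u) :
    ∀ g : ℕ,
      (u - v) / (u - t * v) ∈ Set.Icc (0 : ℝ) 1 ∧
      ((1 - s * t ^ g * u) * (v - s * t ^ g)) /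
          ((1 - s * t ^ g * v) * (u - s * t ^ g)) ∈ Set.Icc (0 : ℝ) 1 ∧
      ((1 - t) * (1 - s ^ 2 * t ^ (2 * g))) /
          ((1 - t ^ (g + 1)) * (1 - s ^ 2 * t ^ g)) ∈ Set.Icc (0 : ℝ) 1 ∧
      (1 - s * t ^ (g + 1) * v) / (1 - s * t ^ g * v) ∈ Set.Icc (0 : ℝ) 1 ∧
      (t - s * t ^ (g + 1) * u) / (1 - s * t ^ (g + 1) * u) ∈ Set.Icc (0 : ℝ) 1 ∧
      (t * v - s * t ^ (g + 1)) / (v - s * t ^ (g + 1)) ∈ Set.Icc (0 : ℝ) 1 ∧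
      (u - s * t ^ (g + 1)) / (u - s * t ^ g) ∈ Set.Icc (0 : ℝ) 1 ∧
      0 < u - t * v ∧
      0 < (1 - s * t ^ g * v) * (u - s * t ^ g) ∧
      0 < (1 - t ^ (g + 1)) * (1 - s ^ 2 * t ^ g) ∧
      0 < 1 - s * t ^ g * v ∧
      0 < 1 - s * t ^ (g + 1) * u ∧
      0 < v - s * t ^ (g + 1) ∧
      0 < u - s * t ^ g := by
  intro g
  have hx0 : 0 ≤ t ^ g := pow_nonneg ht0 g
  have hx1 : t ^ g ≤ 1 := pow_le_one₀ ht0 ht1.le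
  have hxt : 0 ≤ (1 - t ^ g) * (t - s ^ 2 * t ^ g) := by
    rcases Nat.eq_zero_or_pos g with rfl | hg
    · simp
    · have hxle : t ^ g ≤ t := pow_le_of_le_one ht0 ht1.le hg.ne'
      have : s ^ 2 * t ^ g ≤ t ^ g := mul_le_of_le_one_left hx0 (by nlinarith)
      exact mul_nonneg (by linarith) (by linarith)
  rw [pow_succ t g, mul_comm 2 g, pow_mul]
  generalize t ^ g = x at hx0 hx1 hxt ⊢
  have hu : 0 < u := hv.trans_le huv
  obtain ⟨a, ha⟩ : ∃ a, a = -(s * x) := ⟨_, rfl⟩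
  have ha0 : 0 ≤ a := by nlinarith
  have ha1 : a ≤ 1 := by nlinarith
  have hat0 : 0 ≤ a * t := mul_nonneg ha0 ht0
  have hat1 : a * t ≤ a := mul_le_of_le_one_right ha0 ht1.le
  have hav : 0 ≤ a * v := mul_nonneg ha0 hv.le
  have hau : 0 ≤ a * u := mul_nonneg ha0 hu.le
  have hatu : 0 ≤ a * t * u := mul_nonneg hat0 hu.le
  have hatv : 0 ≤ a * t * v := mul_nonneg hat0 hv.le
  have htv : t * v < v := mul_lt_of_lt_one_left hv ht1
  have htv0 : 0 ≤ t * v := mul_nonneg ht0 hv.le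
  have hsx : s * x = -a := by linarith
  have hsxt : s * (x * t) = -(a * t) := by rw [← mul_assoc, hsx, neg_mul]
  have hsq : s ^ 2 * x ^ 2 = a ^ 2 := by rw [ha]; ring
  have hs2 : s ^ 2 < 1 := by nlinarith
  have hd : 0 < (1 - x * t) * (1 - s ^ 2 * x) :=
    mul_pos (by nlinarith) (by nlinarith [sq_nonneg s])
  have hn : (1 - t) * (1 - a ^ 2) ≤ (1 - x * t) * (1 - s ^ 2 * x) := by
    rw [← hsq]; linarith
  have hn0 : 0 ≤ (1 - t) * (1 - a ^ 2) := mul_nonneg (by linarith) (by nlinarith)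
  have hq : 0 ≤ (u - v) * (1 - a ^ 2) := mul_nonneg (by linarith) (by nlinarith)
  have div_mem_unit {p q : ℝ} (hp : 0 ≤ p) (hq : 0 < q) (hpq : p ≤ q) :
      p / q ∈ Set.Icc (0 : ℝ) 1 := ⟨div_nonneg hp hq.le, (div_le_one hq).2 hpq⟩
  simp only [hsx, hsxt, hsq, neg_mul, sub_neg_eq_add]
  have hden : 0 < (1 + a * v) * (u + a) := mul_pos (by linarith) (by linarith)
  refine ⟨div_mem_unit ?_ ?_ ?_,
    div_mem_unit (mul_nonneg (by linarith) (by linarith)) hden (by linarith),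
    div_mem_unit hn0 hd hn, div_mem_unit ?_ ?_ ?_, div_mem_unit ?_ ?_ ?_,
    div_mem_unit ?_ ?_ ?_, div_mem_unit ?_ ?_ ?_, ?_, hden, hd, ?_, ?_, ?_, ?_⟩ <;>
  first | linarith | nlinarith
end

section
/- Let u1, u2, v, s, t be real numbers and ℓ a natural number, and assume u1 - t·u2 ≠ 0, u1 - s·t^ℓ ≠ 0, v - t·u1 ≠ 0, s·t^ℓ - v ≠ 0, v - t·u2 ≠ 0, v - s·t^ℓ ≠ 0, and u1 - s·t^(ℓ+1) ≠ 0. Then ((1-t)·u1·(u2 - s·t^ℓ)) / ((u1 - t·u2)·(u1 - s·t^ℓ)) · ((v - u1)·(s·t^(ℓ+1) - v)) / ((v - t·u1)·(s·t^ℓ - v)) + ((u1 - u2)·(u1 - s·t^(ℓ+1))) / ((u1 - t·u2)·(u1 - s·t^ℓ)) · ((1-t)·v·(u2 - s·t^ℓ)) / ((v - t·u2)·(v - s·t^ℓ)) · ((1-t)·u1·(v - s·t^(ℓ+1))) / ((v - t·u1)·(u1 - s·t^(ℓ+1))) = ((v - u2)·(s·t^(ℓ+1) - v)) / ((v - t·u2)·(s·t^ℓ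 - v)) · ((1-t)·u1·(u2 - s·t^ℓ)) / ((u1 - t·u2)·(u1 - s·t^ℓ)). -/
/-- One of the case identities comprising the dynamic Yang-Baxter equation
for the dynamic stochastic six vertex model. -/
theorem dynamic_YB_case (u1 u2 v s t : ℝ) (ℓ : ℕ)
    (h1 : u1 - t * u2 ≠ 0) (h2 : u1 - s * t ^ ℓ ≠ 0)
    (h3 : v - t * u1 ≠ 0) (h4 : s * t ^ ℓ - v ≠ 0)
    (h5 : v - t * u2 ≠ 0) (h6 : v - s * t ^ ℓ ≠ 0)
    (h7 : u1 - s * t ^ (ℓ + 1) ≠ 0) :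
    ((1 - t) * u1 * (u2 - s * t ^ ℓ)) / ((u1 - t * u2) * (u1 - s * t ^ ℓ)) *
        (((v - u1) * (s * t ^ (ℓ + 1) - v)) / ((v - t * u1) * (s * t ^ ℓ - v))) +
      ((u1 - u2) * (u1 - s * t ^ (ℓ + 1))) / ((u1 - t * u2) * (u1 - s * t ^ ℓ)) *
        (((1 - t) * v * (u2 - s * t ^ ℓ)) / ((v - t * u2) * (v - s * t ^ ℓ))) *
        (((1 - t) * u1 * (v - s * t ^ (ℓ + 1))) / ((v - t * u1) * (u1 - s * t ^ (ℓ + 1)))) =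
    ((v - u2) * (s * t ^ (ℓ + 1) - v)) / ((v - t * u2) * (s * t ^ ℓ - v)) *
        (((1 - t) * u1 * (u2 - s * t ^ ℓ)) / ((u1 - t * u2) * (u1 - s * t ^ ℓ))) := by
  generalize s * t ^ (ℓ + 1) = b at *
  generalize s * t ^ ℓ = a at *
  have key : (v - u1) / (v - t * u1) + (u1 - u2) * ((1 - t) * v) / ((v - t * u2) * (v - t * u1)) =
      (v - u2) / (v - t * u2) := by
    rw [div_add_div _ _ h3 (mul_ne_zero h5 h3),
      div_eq_div_iff (mul_ne_zero h3 (mul_ne_zero h5 h3)) h5]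
    ring
  have hneg : (b - v) / (a - v) = (v - b) / (v - a) := by
    rw [← neg_sub v b, ← neg_sub v a, neg_div_neg_eq]
  have hcancel : (u1 - b) / (u1 - b) = 1 := div_self h7
  calc
    _ = (1 - t) * u1 * (u2 - a) / ((u1 - t * u2) * (u1 - a)) *
        ((v - u1) / (v - t * u1) * ((b - v) / (a - v)) +
          (u1 - u2) * ((1 - t) * v) / ((v - t * u2) * (v - t * u1)) *
            ((v - b) / (v - a)) * ((u1 - b) / (u1 - b))) := by
      simp only [div_eq_mul_inv, mul_inv]
      ring
    _ = (1 - t) * u1 * (u2 - a) / ((u1 - t * u2) * (u1 - a)) *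
        ((v - u2) / (v - t * u2) * ((b - v) / (a - v))) := by
      rw [hcancel, mul_one, hneg, ← add_mul, key]
    _ = _ := by rw [div_mul_div_comm (v - u2), mul_comm]
end
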